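/- arXiv:2405.16013 — 3 statements merged into one kernel-verified Lean document; each statement's English description precedes it below -/
import Mathlib

section
/- (BF dominates one-coin Dawid–Skene when given the empirical parameters.) Take b = b* = A η and ε = 0, and let g^{bf*} ∈ Δ_k^n attain sup_{g ∈ Δ_k^n} inf_{z ∈ P(b*,0)} z·log g. Then for all class frequencies w : Fin k → ℝ with 0 ≤ w_ℓ ≤ 1 and Σ_ℓ w_ℓ = 1 and all rule accuracies β : Fin p → ℝ with 0 ≤ β_j ≤ 1, such that the OCDS normalizer Σ_{ℓ'} N_{iℓ'} is positive for every i (so that g^{ds}(w,β) is well defined), one has d(η, g^{bf*}) ≤ d(η, g^{ds}(w,β)). -/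
open Finset

attribute [local instance] Classical.propDecidable

noncomputable section

/-- The simplex `Δ_k^n`: rows are probability distributions over `Fin k`. -/
def Simplex (n k : ℕ) : Set (Fin n → Fin k → ℝ) :=
  {z | (∀ i ℓ, 0 ≤ z i ℓ) ∧ ∀ i, ∑ ℓ, z i ℓ = 1}

/-- Number of points where rule `j` does not abstain. -/
def nRule {n k p : ℕ} (h : Fin p → Fin n → Option (Fin k)) (j : Fin p) : ℕ :=
  (Finset.univ.filter (fun i => h j i ≠ none)).card

/-- The constraint matrix `A`, with `m = p + k` rows indexed by `Fin p ⊕ Fin k`. -/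
def Amat {n k p : ℕ} (h : Fin p → Fin n → Option (Fin k)) :
    Fin p ⊕ Fin k → Fin n → Fin k → ℝ
  | Sum.inl j => fun i ℓ => if h j i = some ℓ then 1 / (nRule h j : ℝ) else 0
  | Sum.inr ℓ' => fun i ℓ => if ℓ = ℓ' then 1 / (n : ℝ) else 0

/-- `(A z)_j`. -/
def applyA {n k p : ℕ} (h : Fin p → Fin n → Option (Fin k))
    (z : Fin n → Fin k → ℝ) (j : Fin p ⊕ Fin k) : ℝ :=
  ∑ i, ∑ ℓ, Amat h j i ℓ * z i ℓ

/-- The polytope `P(b, ε)`. -/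
def Polytope {n k p : ℕ} (h : Fin p → Fin n → Option (Fin k))
    (b ε : Fin p ⊕ Fin k → ℝ) : Set (Fin n → Fin k → ℝ) :=
  {z | z ∈ Simplex n k ∧ ∀ j, b j - ε j ≤ applyA h z j ∧ applyA h z j ≤ b j + ε j}

/-- Extended-real logarithm, with `elog 0 = ⊥ = -∞`. -/
def elog (x : ℝ) : EReal := if x = 0 then ⊥ else ((Real.log x : ℝ) : EReal)

/-- `z · log g`, valued in `[-∞, 0]` with the convention `0 · log 0 = 0`. -/
def dotlog {n k : ℕ} (z g : Fin n → Fin k → ℝ) : EReal :=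
  ∑ i, ∑ ℓ, (z i ℓ : EReal) * elog (g i ℓ)

/-- `a^{(θ)}_{iℓ} = Σ_j θ_j · A j i ℓ`. -/
def avec {n k p : ℕ} (h : Fin p → Fin n → Option (Fin k))
    (θ : Fin p ⊕ Fin k → ℝ) (i : Fin n) (ℓ : Fin k) : ℝ :=
  ∑ j, θ j * Amat h j i ℓ

/-- The exponential-family (softmax) prediction `g^{(θ)}`. -/
def gexp {n k p : ℕ} (h : Fin p → Fin n → Option (Fin k))
    (θ : Fin p ⊕ Fin k → ℝ) (i : Fin n) (ℓ : Fin k) : ℝ :=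
  Real.exp (avec h θ i ℓ) / ∑ ℓ', Real.exp (avec h θ i ℓ')

/-- The BF dual objective `(σ'−σ)·b − (σ'+σ)·ε − Σ_i log(Σ_ℓ exp(a^{(σ'−σ)}_{iℓ}))`. -/
def dualObj {n k p : ℕ} (h : Fin p → Fin n → Option (Fin k))
    (b ε σ σ' : Fin p ⊕ Fin k → ℝ) : ℝ :=
  (∑ j, (σ' j - σ j) * b j) - (∑ j, (σ' j + σ j) * ε j)
    - ∑ i, Real.log (∑ ℓ, Real.exp (avec h (fun j => σ' j - σ j) i ℓ))

/-- KL summand `a·log(a/c)`, with `0·log(0/c) = 0` and `a·log(a/0) = ⊤` for `a ≠ 0`. -/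
def klTerm (a c : ℝ) : EReal :=
  if a = 0 then 0 else if c = 0 then ⊤ else ((a * Real.log (a / c) : ℝ) : EReal)

/-- `d(μ, ν)`, the summed KL divergences, valued in `[0, +∞]`. -/
def dKL {n k : ℕ} (μ ν : Fin n → Fin k → ℝ) : EReal :=
  ∑ i, ∑ ℓ, klTerm (μ i ℓ) (ν i ℓ)

/-- Unnormalized one-coin Dawid–Skene score `N_{iℓ}`. -/
def Nds {n k p : ℕ} (h : Fin p → Fin n → Option (Fin k))
    (w : Fin k → ℝ) (β : Fin p → ℝ) (i : Fin n) (ℓ : Fin k) : ℝ :=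
  w ℓ * (∏ j ∈ Finset.univ.filter (fun j => h j i = some ℓ), β j)
    * ∏ j ∈ Finset.univ.filter (fun j => ∃ ℓ' ≠ ℓ, h j i = some ℓ'),
        (1 - β j) / ((k : ℝ) - 1)

/-- The one-coin Dawid–Skene prediction `g^{ds}(w, β)`. -/
def gds {n k p : ℕ} (h : Fin p → Fin n → Option (Fin k))
    (w : Fin k → ℝ) (β : Fin p → ℝ) (i : Fin n) (ℓ : Fin k) : ℝ :=
  Nds h w β i ℓ / ∑ ℓ', Nds h w β i ℓ'

/-- The mass that `z` puts on the pairs satisfying `Q`. -/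
def massOn {n k : ℕ} (Q : Fin n → Fin k → Prop) (z : Fin n → Fin k → ℝ) : ℝ :=
  ∑ i, ∑ ℓ, if Q i ℓ then z i ℓ else 0

lemma exists_ne_zero_of_massOn_eq {n k : ℕ} {Q : Fin n → Fin k → Prop} {z η : Fin n → Fin k → ℝ}
    (hz : ∀ i ℓ, 0 ≤ z i ℓ) (h : massOn Q z = massOn Q η) {i : Fin n} {ℓ : Fin k}
    (hQ : Q i ℓ) (hpos : z i ℓ ≠ 0) : ∃ i' ℓ', Q i' ℓ' ∧ η i' ℓ' ≠ 0 := by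
  by_contra! hcon
  have h0 : massOn Q η = 0 :=
    Finset.sum_eq_zero fun i' _ => Finset.sum_eq_zero fun ℓ' _ => by
      split_ifs with hq
      · exact hcon _ _ hq
      · rfl
  rw [h0] at h
  have hnn : ∀ i' ℓ', 0 ≤ if Q i' ℓ' then z i' ℓ' else 0 := fun i' ℓ' => by
    split_ifs
    · exact hz _ _
    · exact le_rfl
  have h1 := (Finset.sum_eq_zero_iff_of_nonneg
    fun i' _ => Finset.sum_nonneg fun ℓ' _ => hnn i' ℓ').1 h i (Finset.mem_univ i)
  have h2 := (Finset.sum_eq_zero_iff_of_nonneg fun ℓ' _ => hnn i ℓ').1 h1 ℓ (Finset.mem_univ ℓ)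
  rw [if_pos hQ] at h2
  exact hpos h2

lemma sum_mul_ite_eq_mul_massOn {n k : ℕ} (Q : Fin n → Fin k → Prop) (z : Fin n → Fin k → ℝ)
    (c : ℝ) : ∑ i, ∑ ℓ, z i ℓ * (if Q i ℓ then c else 0) = c * massOn Q z := by
  simp only [massOn, Finset.mul_sum]
  refine Finset.sum_congr rfl fun i _ => Finset.sum_congr rfl fun ℓ _ => ?_
  split_ifs <;> ring

lemma applyA_inr {n k p : ℕ} (h : Fin p → Fin n → Option (Fin k)) (z : Fin n → Fin k → ℝ)
    (ℓ' : Fin k) : applyA h z (Sum.inr ℓ') = 1 / (n : ℝ) * massOn (fun _ ℓ => ℓ = ℓ') z := by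
  simp only [applyA, Amat, massOn, Finset.mul_sum]
  refine Finset.sum_congr rfl fun i _ => Finset.sum_congr rfl fun ℓ _ => ?_
  split_ifs <;> ring

lemma applyA_inl {n k p : ℕ} (h : Fin p → Fin n → Option (Fin k)) (z : Fin n → Fin k → ℝ)
    (j : Fin p) :
    applyA h z (Sum.inl j) = 1 / (nRule h j : ℝ) * massOn (fun i ℓ => h j i = some ℓ) z := by
  simp only [applyA, Amat, massOn, Finset.mul_sum]
  refine Finset.sum_congr rfl fun i _ => Finset.sum_congr rfl fun ℓ _ => ?_
  split_ifs <;> ring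

lemma massOn_correct_add_massOn_wrong {n k p : ℕ} (h : Fin p → Fin n → Option (Fin k))
    {z : Fin n → Fin k → ℝ} (hz : z ∈ Simplex n k) (j : Fin p) :
    massOn (fun i ℓ => h j i = some ℓ) z + massOn (fun i ℓ => ∃ ℓ' ≠ ℓ, h j i = some ℓ') z
      = nRule h j := by
  simp only [massOn, nRule, Finset.card_filter, Nat.cast_sum]
  rw [← Finset.sum_add_distrib]
  refine Finset.sum_congr rfl fun i _ => ?_
  rw [← Finset.sum_add_distrib]
  rcases Option.eq_none_or_eq_some (h j i) with hji | ⟨m, hji⟩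
  · simp [hji]
  · have hcast : ((if h j i ≠ none then 1 else 0 : ℕ) : ℝ) = 1 := by simp [hji]
    rw [hcast, ← hz.2 i]
    refine Finset.sum_congr rfl fun ℓ _ => ?_
    by_cases hm : m = ℓ <;> simp [hji, hm]

lemma applyA_eq_of_mem_polytope {n k p : ℕ} {h : Fin p → Fin n → Option (Fin k)}
    {b : Fin p ⊕ Fin k → ℝ} {z : Fin n → Fin k → ℝ} (hz : z ∈ Polytope h b 0)
    (j : Fin p ⊕ Fin k) : applyA h z j = b j := by
  have := hz.2 j
  simp only [Pi.zero_apply, sub_zero, add_zero] at this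
  exact le_antisymm this.2 this.1

lemma sum_coe_ereal {ι : Type*} (s : Finset ι) (f : ι → ℝ) :
    ∑ x ∈ s, (f x : EReal) = ((∑ x ∈ s, f x : ℝ) : EReal) :=
  (map_sum (⟨⟨Real.toEReal, EReal.coe_zero⟩, EReal.coe_add⟩ : ℝ →+ EReal) f s).symm

lemma ereal_sum_eq_bot {ι : Type*} [Fintype ι] (f : ι → EReal) {x : ι} (hx : f x = ⊥) :
    ∑ y, f y = ⊥ := by
  rw [← Finset.add_sum_erase _ _ (Finset.mem_univ x), hx, EReal.bot_add]

lemma ereal_sum_ne_bot {ι : Type*} (s : Finset ι) (f : ι → EReal) (hf : ∀ y, f y ≠ ⊥) :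
    ∑ y ∈ s, f y ≠ ⊥ := by
  induction s using Finset.cons_induction with
  | empty => simp
  | cons a s ha ih =>
    rw [Finset.sum_cons, Ne, EReal.add_eq_bot_iff, not_or]
    exact ⟨hf a, ih⟩

lemma ereal_sum_eq_top {ι : Type*} [Fintype ι] (f : ι → EReal) (hf : ∀ y, f y ≠ ⊥) {x : ι}
    (hx : f x = ⊤) : ∑ y, f y = ⊤ := by
  rw [← Finset.add_sum_erase _ _ (Finset.mem_univ x), hx,
    EReal.top_add_of_ne_bot (ereal_sum_ne_bot _ _ hf)]

lemma klTerm_ne_bot (a c : ℝ) : klTerm a c ≠ ⊥ := by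
  unfold klTerm
  split_ifs
  · simp
  · simp
  · exact EReal.coe_ne_bot _

lemma dotlog_eq_coe {n k : ℕ} {z g : Fin n → Fin k → ℝ} (hzg : ∀ i ℓ, z i ℓ ≠ 0 → g i ℓ ≠ 0) :
    dotlog z g = ((∑ i, ∑ ℓ, z i ℓ * Real.log (g i ℓ) : ℝ) : EReal) := by
  unfold dotlog
  rw [← sum_coe_ereal]
  refine Finset.sum_congr rfl fun i _ => ?_
  rw [← sum_coe_ereal]
  refine Finset.sum_congr rfl fun ℓ _ => ?_
  by_cases hz : z i ℓ = 0
  · simp [hz]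
  · simp [elog, hzg i ℓ hz]

lemma dotlog_eq_bot {n k : ℕ} {z g : Fin n → Fin k → ℝ} {i : Fin n} {ℓ : Fin k}
    (hz : 0 < z i ℓ) (hg : g i ℓ = 0) : dotlog z g = ⊥ := by
  refine ereal_sum_eq_bot _ (x := i) (ereal_sum_eq_bot _ (x := ℓ) ?_)
  simp only [elog, hg, if_true]
  exact EReal.coe_mul_bot_of_pos hz

lemma dKL_eq_coe {n k : ℕ} {μ ν : Fin n → Fin k → ℝ} (h : ∀ i ℓ, μ i ℓ ≠ 0 → ν i ℓ ≠ 0) :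
    dKL μ ν = ((∑ i, ∑ ℓ, μ i ℓ * Real.log (μ i ℓ)
      - ∑ i, ∑ ℓ, μ i ℓ * Real.log (ν i ℓ) : ℝ) : EReal) := by
  unfold dKL
  rw [← Finset.sum_sub_distrib, ← sum_coe_ereal]
  refine Finset.sum_congr rfl fun i _ => ?_
  rw [← Finset.sum_sub_distrib, ← sum_coe_ereal]
  refine Finset.sum_congr rfl fun ℓ _ => ?_
  by_cases hμ : μ i ℓ = 0
  · simp [klTerm, hμ]
  · simp only [klTerm, hμ, h i ℓ hμ, if_false]
    rw [Real.log_div hμ (h i ℓ hμ), mul_sub]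

lemma dKL_eq_top {n k : ℕ} {μ ν : Fin n → Fin k → ℝ} {i : Fin n} {ℓ : Fin k}
    (hμ : μ i ℓ ≠ 0) (hν : ν i ℓ = 0) : dKL μ ν = ⊤ := by
  refine ereal_sum_eq_top _ (fun _ => ereal_sum_ne_bot _ _ fun _ => klTerm_ne_bot _ _) (x := i)
    (ereal_sum_eq_top _ (fun _ => klTerm_ne_bot _ _) (x := ℓ) ?_)
  simp [klTerm, hμ, hν]

lemma dKL_le_dKL_of_dotlog_le {n k : ℕ} {μ ν ν' : Fin n → Fin k → ℝ}
    (hμ : ∀ i ℓ, 0 ≤ μ i ℓ) (hν : ∀ i ℓ, μ i ℓ ≠ 0 → ν i ℓ ≠ 0)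
    (hle : dotlog μ ν ≤ dotlog μ ν') : dKL μ ν' ≤ dKL μ ν := by
  have hν' : ∀ i ℓ, μ i ℓ ≠ 0 → ν' i ℓ ≠ 0 := fun i ℓ h0 h1 => by
    rw [dotlog_eq_coe hν, dotlog_eq_bot ((hμ i ℓ).lt_of_ne' h0) h1, le_bot_iff] at hle
    exact EReal.coe_ne_bot _ hle
  rw [dotlog_eq_coe hν, dotlog_eq_coe hν', EReal.coe_le_coe_iff] at hle
  rw [dKL_eq_coe hν, dKL_eq_coe hν', EReal.coe_le_coe_iff]
  linarith

lemma log_Nds {n k p : ℕ} {h : Fin p → Fin n → Option (Fin k)} {w : Fin k → ℝ} {β : Fin p → ℝ}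
    {i : Fin n} {ℓ : Fin k} (hN : Nds h w β i ℓ ≠ 0) :
    Real.log (Nds h w β i ℓ) = (∑ m, if ℓ = m then Real.log (w m) else 0)
      + (∑ j, if h j i = some ℓ then Real.log (β j) else 0)
      + ∑ j, if ∃ ℓ' ≠ ℓ, h j i = some ℓ' then Real.log ((1 - β j) / ((k : ℝ) - 1)) else 0 := by
  have h1 := left_ne_zero_of_mul hN
  have h2 := right_ne_zero_of_mul hN
  have h3 := right_ne_zero_of_mul h1
  rw [Nds, Real.log_mul h1 h2, Real.log_mul (left_ne_zero_of_mul h1) h3,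
    Real.log_prod (Finset.prod_ne_zero_iff.1 h3), Real.log_prod (Finset.prod_ne_zero_iff.1 h2),
    Finset.sum_filter, Finset.sum_filter]
  simp

/-- The score `z · log g^{ds}` depends on `z` only through its class, correct-vote and wrong-vote
masses. -/
lemma sum_mul_log_gds {n k p : ℕ} {h : Fin p → Fin n → Option (Fin k)} {w : Fin k → ℝ}
    {β : Fin p → ℝ} {z : Fin n → Fin k → ℝ} (hz : z ∈ Simplex n k)
    (hZ : ∀ i, 0 < ∑ ℓ', Nds h w β i ℓ') (hsupp : ∀ i ℓ, z i ℓ ≠ 0 → Nds h w β i ℓ ≠ 0) :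
    ∑ i, ∑ ℓ, z i ℓ * Real.log (gds h w β i ℓ)
      = (∑ m, Real.log (w m) * massOn (fun _ ℓ => ℓ = m) z)
        + (∑ j, Real.log (β j) * massOn (fun i ℓ => h j i = some ℓ) z)
        + (∑ j, Real.log ((1 - β j) / ((k : ℝ) - 1))
            * massOn (fun i ℓ => ∃ ℓ' ≠ ℓ, h j i = some ℓ') z)
        - ∑ i, Real.log (∑ ℓ', Nds h w β i ℓ') := by
  have swap {m : ℕ} (Q : Fin m → Fin n → Fin k → Prop) (c : Fin m → ℝ) :
      ∑ j, c j * massOn (Q j) z = ∑ i, ∑ ℓ, z i ℓ * ∑ j, if Q j i ℓ then c j else 0 := by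
    simp only [← sum_mul_ite_eq_mul_massOn, Finset.mul_sum]
    rw [Finset.sum_comm]
    exact Finset.sum_congr rfl fun i _ => Finset.sum_comm
  rw [swap (fun m _ ℓ => ℓ = m), swap (fun j i ℓ => h j i = some ℓ),
    swap (fun j i ℓ => ∃ ℓ' ≠ ℓ, h j i = some ℓ'), ← Finset.sum_add_distrib,
    ← Finset.sum_add_distrib, ← Finset.sum_sub_distrib]
  refine Finset.sum_congr rfl fun i _ => ?_
  have hlogZ : Real.log (∑ ℓ', Nds h w β i ℓ')
      = ∑ ℓ, z i ℓ * Real.log (∑ ℓ', Nds h w β i ℓ') := by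
    rw [← Finset.sum_mul, hz.2 i, one_mul]
  rw [hlogZ, ← Finset.sum_add_distrib, ← Finset.sum_add_distrib, ← Finset.sum_sub_distrib]
  refine Finset.sum_congr rfl fun ℓ _ => ?_
  by_cases h0 : z i ℓ = 0
  · simp [h0]
  · rw [gds, Real.log_div (hsupp i ℓ h0) (hZ i).ne', log_Nds (hsupp i ℓ h0), mul_sub,
      mul_add, mul_add]
    congr!

lemma Nds_ne_zero_of_massOn_eq {n k p : ℕ} {h : Fin p → Fin n → Option (Fin k)} {w : Fin k → ℝ}
    {β : Fin p → ℝ} {z η : Fin n → Fin k → ℝ} (hz : ∀ i ℓ, 0 ≤ z i ℓ)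
    (hclass : ∀ m, massOn (fun _ ℓ => ℓ = m) z = massOn (fun _ ℓ => ℓ = m) η)
    (hcorrect : ∀ j, massOn (fun i ℓ => h j i = some ℓ) z = massOn (fun i ℓ => h j i = some ℓ) η)
    (hwrong : ∀ j, massOn (fun i ℓ => ∃ ℓ' ≠ ℓ, h j i = some ℓ') z
      = massOn (fun i ℓ => ∃ ℓ' ≠ ℓ, h j i = some ℓ') η)
    (hη : ∀ i ℓ, η i ℓ ≠ 0 → Nds h w β i ℓ ≠ 0) (i : Fin n) (ℓ : Fin k) (h0 : z i ℓ ≠ 0) :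
    Nds h w β i ℓ ≠ 0 := by
  refine mul_ne_zero (mul_ne_zero ?_ (Finset.prod_ne_zero_iff.2 fun j hj => ?_))
    (Finset.prod_ne_zero_iff.2 fun j hj => ?_)
  · obtain ⟨i', ℓ', rfl, h1⟩ := exists_ne_zero_of_massOn_eq hz (hclass ℓ) rfl h0
    exact left_ne_zero_of_mul (left_ne_zero_of_mul (hη _ _ h1))
  · obtain ⟨i', ℓ', hQ, h1⟩ :=
      exists_ne_zero_of_massOn_eq hz (hcorrect j) (Finset.mem_filter.1 hj).2 h0
    exact Finset.prod_ne_zero_iff.1 (right_ne_zero_of_mul (left_ne_zero_of_mul (hη _ _ h1))) j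
      (Finset.mem_filter.2 ⟨Finset.mem_univ j, hQ⟩)
  · obtain ⟨i', ℓ', hQ, h1⟩ :=
      exists_ne_zero_of_massOn_eq hz (hwrong j) (Finset.mem_filter.1 hj).2 h0
    exact Finset.prod_ne_zero_iff.1 (right_ne_zero_of_mul (hη _ _ h1)) j
      (Finset.mem_filter.2 ⟨Finset.mem_univ j, hQ⟩)

lemma dotlog_gds_eq_of_mem_polytope {n k p : ℕ} (hn : 0 < n)
    {h : Fin p → Fin n → Option (Fin k)} (hnj : ∀ j, 0 < nRule h j) {w : Fin k → ℝ}
    {β : Fin p → ℝ} {z η : Fin n → Fin k → ℝ} (hη : η ∈ Simplex n k)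
    (hz : z ∈ Polytope h (applyA h η) 0) (hZ : ∀ i, 0 < ∑ ℓ', Nds h w β i ℓ')
    (hsupp : ∀ i ℓ, η i ℓ ≠ 0 → gds h w β i ℓ ≠ 0) :
    dotlog z (gds h w β) = dotlog η (gds h w β) := by
  have hN : ∀ i ℓ, η i ℓ ≠ 0 → Nds h w β i ℓ ≠ 0 := fun i ℓ h0 h1 =>
    hsupp i ℓ h0 (by rw [gds, h1, zero_div])
  have hclass : ∀ m, massOn (fun _ ℓ => ℓ = m) z = massOn (fun _ ℓ => ℓ = m) η := fun m => by
    have hA := applyA_eq_of_mem_polytope hz (Sum.inr m)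
    rw [applyA_inr, applyA_inr] at hA
    exact mul_left_cancel₀ (by positivity) hA
  have hcorrect : ∀ j, massOn (fun i ℓ => h j i = some ℓ) z
      = massOn (fun i ℓ => h j i = some ℓ) η := fun j => by
    have hA := applyA_eq_of_mem_polytope hz (Sum.inl j)
    rw [applyA_inl, applyA_inl] at hA
    have := hnj j
    exact mul_left_cancel₀ (by positivity) hA
  have hwrong : ∀ j, massOn (fun i ℓ => ∃ ℓ' ≠ ℓ, h j i = some ℓ') z
      = massOn (fun i ℓ => ∃ ℓ' ≠ ℓ, h j i = some ℓ') η := fun j => by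
    have h1 := massOn_correct_add_massOn_wrong h hz.1 j
    have h2 := massOn_correct_add_massOn_wrong h hη j
    linarith [hcorrect j]
  have hNz := Nds_ne_zero_of_massOn_eq hz.1.1 hclass hcorrect hwrong hN
  have hsuppz : ∀ i ℓ, z i ℓ ≠ 0 → gds h w β i ℓ ≠ 0 := fun i ℓ h0 =>
    div_ne_zero (hNz i ℓ h0) (hZ i).ne'
  rw [dotlog_eq_coe hsupp, dotlog_eq_coe hsuppz,
    sum_mul_log_gds hz.1 hZ hNz, sum_mul_log_gds hη hZ hN]
  simp only [hclass, hcorrect, hwrong]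

lemma gds_mem_simplex {n k p : ℕ} (hk : 2 ≤ k) {h : Fin p → Fin n → Option (Fin k)}
    {w : Fin k → ℝ} {β : Fin p → ℝ} (hw : ∀ ℓ, 0 ≤ w ℓ) (hβ : ∀ j, 0 ≤ β j ∧ β j ≤ 1)
    (hZ : ∀ i, 0 < ∑ ℓ', Nds h w β i ℓ') : gds h w β ∈ Simplex n k := by
  have hk' : (2 : ℝ) ≤ k := by exact_mod_cast hk
  refine ⟨fun i ℓ => div_nonneg (mul_nonneg (mul_nonneg (hw ℓ) ?_) ?_) (hZ i).le, fun i => ?_⟩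
  · exact Finset.prod_nonneg fun j _ => (hβ j).1
  · exact Finset.prod_nonneg fun j _ => div_nonneg (by linarith [(hβ j).2]) (by linarith)
  · simp only [gds]
    rw [← Finset.sum_div, div_self (hZ i).ne']

/-- BF with the empirical parameters dominates every well-defined
one-coin Dawid–Skene prediction. -/
theorem stmt15 {n k p : ℕ} (hn : 0 < n) (hk : 2 ≤ k) (hp : 0 < p)
    (h : Fin p → Fin n → Option (Fin k)) (hnj : ∀ j, 0 < nRule h j)
    (η : Fin n → Fin k → ℝ) (hη : η ∈ Simplex n k)
    (gbfstar : Fin n → Fin k → ℝ) (hg : gbfstar ∈ Simplex n k)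
    (hopt : (⨅ z ∈ Polytope h (applyA h η) 0, dotlog z gbfstar)
        = ⨆ g ∈ Simplex n k, ⨅ z ∈ Polytope h (applyA h η) 0, dotlog z g)
    (w : Fin k → ℝ) (β : Fin p → ℝ)
    (hw : ∀ ℓ, 0 ≤ w ℓ ∧ w ℓ ≤ 1) (hwsum : ∑ ℓ, w ℓ = 1)
    (hβ : ∀ j, 0 ≤ β j ∧ β j ≤ 1)
    (hZ : ∀ i, 0 < ∑ ℓ', Nds h w β i ℓ') :
    dKL η gbfstar ≤ dKL η (gds h w β) := by
  by_cases hsupp : ∀ i ℓ, η i ℓ ≠ 0 → gds h w β i ℓ ≠ 0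
  · refine dKL_le_dKL_of_dotlog_le hη.1 hsupp ?_
    have hmem : η ∈ Polytope h (applyA h η) 0 := ⟨hη, fun j => by simp⟩
    calc dotlog η (gds h w β)
        ≤ ⨅ z ∈ Polytope h (applyA h η) 0, dotlog z (gds h w β) :=
          le_iInf₂ fun z hz => (dotlog_gds_eq_of_mem_polytope hn hnj hη hz hZ hsupp).ge
      _ ≤ ⨆ g ∈ Simplex n k, ⨅ z ∈ Polytope h (applyA h η) 0, dotlog z g :=
          le_iSup₂_of_le (gds h w β) (gds_mem_simplex hk (fun ℓ => (hw ℓ).1) hβ hZ) le_rfl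
      _ = ⨅ z ∈ Polytope h (applyA h η) 0, dotlog z gbfstar := hopt.symm
      _ ≤ dotlog η gbfstar := iInf₂_le η hmem
  · push Not at hsupp
    obtain ⟨i, ℓ, h0, h1⟩ := hsupp
    rw [dKL_eq_top h0 h1]
    exact le_top
end
end

section
/- (ℓ1-regularized multiclass logistic regression is a BF maximum-entropy problem.) Fix positive integers n, k, d_feat with k ≥ 2, features x : Fin n → Fin d_feat → ℝ, η ∈ Δ_k^n, and C ≥ 0. Define b*_{(c,ℓ)} := Σ_i x i c · η_{iℓ} and the polytope P' := { z ∈ Δ_k^n : ∀ c : Fin d_feat, ∀ ℓ : Fin k, | Σ_i x i c · z_{iℓ} − b*_{(c,ℓ)} | ≤ C }. Then −( inf_{z ∈ P'} z·log z ) = inf_{W : Fin k → Fin d_feat → ℝ} [ − Σ_{i,ℓ} η_{iℓ} · log( exp(Σ_c W ℓ c · x i c) / Σ_{ℓ'} exp(Σ_c W ℓ' c · x i c) ) + C · Σ_{ℓ,c} |W ℓ c| ]. -/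
open Finset

attribute [local instance] Classical.propDecidable

noncomputable section

/-- The linear scores `∑ c, W ℓ c * x i c`. -/
def score {n k d : ℕ} (x : Fin n → Fin d → ℝ) (W : Fin k → Fin d → ℝ) (i : Fin n) (ℓ : Fin k) : ℝ :=
  ∑ c, W ℓ c * x i c

/-- The class probabilities predicted by multiclass logistic regression. -/
def softmax {n k d : ℕ} (x : Fin n → Fin d → ℝ) (W : Fin k → Fin d → ℝ) (i : Fin n) (ℓ : Fin k) : ℝ :=
  Real.exp (score x W i ℓ) / ∑ ℓ', Real.exp (score x W i ℓ')

/-- The cross entropy of the labels `p` relative to the predictions `softmax x W`. -/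
def logLoss {n k d : ℕ} (x : Fin n → Fin d → ℝ) (p : Fin n → Fin k → ℝ) (W : Fin k → Fin d → ℝ) : ℝ :=
  -∑ i, ∑ ℓ, p i ℓ * Real.log (softmax x W i ℓ)

/-- The feature moments `∑ i, x i c * z i ℓ`. -/
def moment {n k d : ℕ} (x : Fin n → Fin d → ℝ) (z : Fin n → Fin k → ℝ) (c : Fin d) (ℓ : Fin k) : ℝ :=
  ∑ i, x i c * z i ℓ

/-- The `ℓ1` norm of the weights. -/
def weightNorm {k d : ℕ} (W : Fin k → Fin d → ℝ) : ℝ := ∑ ℓ, ∑ c, |W ℓ c|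

/-- The summed Shannon entropies of the rows of `z`. -/
def rowEntropy {n k : ℕ} (z : Fin n → Fin k → ℝ) : ℝ := ∑ i, ∑ ℓ, Real.negMulLog (z i ℓ)

section

variable {n k d : ℕ} {x : Fin n → Fin d → ℝ} {W : Fin k → Fin d → ℝ}
  {z p q : Fin n → Fin k → ℝ} {C : ℝ}

lemma dotlog_self (z : Fin n → Fin k → ℝ) : dotlog z z = ((-rowEntropy z : ℝ) : EReal) := by
  have h (a : ℝ) : (a : EReal) * elog a = ((-Real.negMulLog a : ℝ) : EReal) := by
    by_cases ha : a = 0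
    · simp [ha, elog]
    · simp [ha, elog, Real.negMulLog]
  have hs {m : ℕ} (f : Fin m → ℝ) : ((∑ i, f i : ℝ) : EReal) = ∑ i, (f i : EReal) :=
    map_sum (⟨⟨Real.toEReal, EReal.coe_zero⟩, EReal.coe_add⟩ : ℝ →+ EReal) f univ
  simp only [dotlog, rowEntropy, h, ← Finset.sum_neg_distrib, hs]

lemma continuous_rowEntropy : Continuous (rowEntropy : (Fin n → Fin k → ℝ) → ℝ) := by
  unfold rowEntropy
  fun_prop

lemma isCompact_simplex (n k : ℕ) : IsCompact (Simplex n k) := by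
  have h : Simplex n k = Set.univ.pi fun _ : Fin n => stdSimplex ℝ (Fin k) := by
    ext z
    simp [Simplex, stdSimplex, forall_and]
  rw [h]
  exact isCompact_univ_pi fun _ => isCompact_stdSimplex ℝ (Fin k)

lemma weightNorm_nonneg (W : Fin k → Fin d → ℝ) : 0 ≤ weightNorm W :=
  sum_nonneg fun _ _ => sum_nonneg fun _ _ => abs_nonneg _

lemma norm_le_weightNorm (W : Fin k → Fin d → ℝ) : ‖W‖ ≤ weightNorm W := by
  refine (pi_norm_le_iff_of_nonneg (weightNorm_nonneg W)).2 fun ℓ =>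
    (pi_norm_le_iff_of_nonneg (weightNorm_nonneg W)).2 fun c => ?_
  calc ‖W ℓ c‖ ≤ ∑ c, |W ℓ c| :=
        single_le_sum (f := fun c => |W ℓ c|) (fun _ _ => abs_nonneg _) (mem_univ c)
    _ ≤ weightNorm W :=
        single_le_sum (f := fun ℓ => ∑ c, |W ℓ c|)
          (fun _ _ => sum_nonneg fun _ _ => abs_nonneg _) (mem_univ ℓ)

lemma weightNorm_add_le (W D : Fin k → Fin d → ℝ) :
    weightNorm (W + D) ≤ weightNorm W + weightNorm D := by
  simp only [weightNorm, ← sum_add_distrib]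
  exact sum_le_sum fun _ _ => sum_le_sum fun _ _ => abs_add_le _ _

lemma weightNorm_smul (t : ℝ) (W : Fin k → Fin d → ℝ) :
    weightNorm (t • W) = |t| * weightNorm W := by
  simp [weightNorm, abs_mul, mul_sum]

lemma sum_exp_pos (hk : 0 < k) (f : Fin k → ℝ) : 0 < ∑ ℓ, Real.exp (f ℓ) :=
  sum_pos (fun _ _ => Real.exp_pos _) ⟨⟨0, hk⟩, mem_univ _⟩

lemma softmax_pos (hk : 0 < k) (i : Fin n) (ℓ : Fin k) : 0 < softmax x W i ℓ :=
  div_pos (Real.exp_pos _) (sum_exp_pos hk _)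

lemma softmax_mem_simplex (hk : 0 < k) : softmax x W ∈ Simplex n k :=
  ⟨fun i ℓ => (softmax_pos hk i ℓ).le, fun i => by
    simp only [softmax, ← sum_div]
    exact div_self (sum_exp_pos hk _).ne'⟩

lemma logLoss_eq (hk : 0 < k) (hp : p ∈ Simplex n k) (W : Fin k → Fin d → ℝ) :
    logLoss x p W = ∑ i, (Real.log (∑ ℓ, Real.exp (score x W i ℓ)) - ∑ ℓ, p i ℓ * score x W i ℓ) := by
  rw [logLoss, ← sum_neg_distrib]
  refine sum_congr rfl fun i _ => ?_
  have h (ℓ : Fin k) : Real.log (softmax x W i ℓ) =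
      score x W i ℓ - Real.log (∑ ℓ, Real.exp (score x W i ℓ)) := by
    rw [softmax, Real.log_div (Real.exp_pos _).ne' (sum_exp_pos hk _).ne', Real.log_exp]
  simp only [h, mul_sub, sum_sub_distrib, ← sum_mul, hp.2 i]
  ring

lemma sum_mul_score (x : Fin n → Fin d → ℝ) (W : Fin k → Fin d → ℝ) (z : Fin n → Fin k → ℝ) :
    ∑ i, ∑ ℓ, z i ℓ * score x W i ℓ = ∑ ℓ, ∑ c, W ℓ c * moment x z c ℓ := by
  simp only [score, moment, mul_sum]
  rw [sum_comm]
  refine sum_congr rfl fun ℓ _ => ?_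
  rw [sum_comm]
  exact sum_congr rfl fun c _ => sum_congr rfl fun i _ => by ring

lemma logLoss_sub_logLoss (hk : 0 < k) (hp : p ∈ Simplex n k) (hq : q ∈ Simplex n k)
    (W : Fin k → Fin d → ℝ) :
    logLoss x p W - logLoss x q W = ∑ ℓ, ∑ c, W ℓ c * (moment x q c ℓ - moment x p c ℓ) := by
  simp only [logLoss_eq hk hp, logLoss_eq hk hq, sum_sub_distrib, mul_sub, ← sum_mul_score]
  ring

lemma logLoss_nonneg (hk : 0 < k) (hp : p ∈ Simplex n k) : 0 ≤ logLoss x p W := by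
  refine neg_nonneg.2 (sum_nonpos fun i _ => sum_nonpos fun ℓ _ =>
    mul_nonpos_of_nonneg_of_nonpos (hp.1 i ℓ) (Real.log_nonpos (softmax_pos hk i ℓ).le ?_))
  rw [← (softmax_mem_simplex hk).2 i]
  exact single_le_sum (f := softmax x W i) (fun ℓ _ => (softmax_pos hk i ℓ).le) (mem_univ ℓ)

lemma negMulLog_le_neg_mul_log_add {a b : ℝ} (ha : 0 ≤ a) (hb : 0 < b) :
    Real.negMulLog a ≤ -(a * Real.log b) + (b - a) := by
  rcases ha.eq_or_lt with rfl | ha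
  · simpa using hb.le
  · have h := mul_le_mul_of_nonneg_left (Real.log_le_sub_one_of_pos (div_pos hb ha)) ha.le
    rw [Real.log_div hb.ne' ha.ne', mul_sub, mul_sub, mul_div_cancel₀ _ ha.ne'] at h
    rw [Real.negMulLog]
    linarith

/-- Gibbs' inequality. -/
lemma rowEntropy_le_logLoss (hk : 0 < k) (hz : z ∈ Simplex n k) : rowEntropy z ≤ logLoss x z W := by
  rw [rowEntropy, logLoss, ← sum_neg_distrib]
  refine sum_le_sum fun i _ => ?_
  calc ∑ ℓ, Real.negMulLog (z i ℓ)
      ≤ ∑ ℓ, (-(z i ℓ * Real.log (softmax x W i ℓ)) + (softmax x W i ℓ - z i ℓ)) :=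
        sum_le_sum fun ℓ _ => negMulLog_le_neg_mul_log_add (hz.1 i ℓ) (softmax_pos hk i ℓ)
    _ = -∑ ℓ, z i ℓ * Real.log (softmax x W i ℓ) := by
        rw [sum_add_distrib, sum_sub_distrib, hz.2 i, (softmax_mem_simplex hk).2 i]
        simp

lemma rowEntropy_softmax : rowEntropy (softmax x W) = logLoss x (softmax x W) W := by
  simp [rowEntropy, logLoss, Real.negMulLog]

lemma rowEntropy_le_logLoss_add (hk : 0 < k) (hz : z ∈ Simplex n k) (hp : p ∈ Simplex n k)
    (h : ∀ c ℓ, |moment x z c ℓ - moment x p c ℓ| ≤ C) (W : Fin k → Fin d → ℝ) :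
    rowEntropy z ≤ logLoss x p W + C * weightNorm W := by
  have h₁ : rowEntropy z ≤ logLoss x z W := rowEntropy_le_logLoss hk hz
  have h₂ := logLoss_sub_logLoss (x := x) hk hz hp W
  have h₃ : ∑ ℓ, ∑ c, W ℓ c * (moment x p c ℓ - moment x z c ℓ) ≤ C * weightNorm W := by
    simp only [weightNorm, mul_sum]
    refine sum_le_sum fun ℓ _ => sum_le_sum fun c _ => ?_
    calc _ ≤ |W ℓ c| * |moment x p c ℓ - moment x z c ℓ| := by
          rw [← abs_mul]; exact le_abs_self _
      _ ≤ |W ℓ c| * C := by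
          rw [abs_sub_comm]
          exact mul_le_mul_of_nonneg_left (h c ℓ) (abs_nonneg _)
      _ = C * |W ℓ c| := mul_comm _ _
  linarith

lemma continuous_logLoss (hk : 0 < k) (hp : p ∈ Simplex n k) : Continuous (logLoss x p) := by
  rw [funext (logLoss_eq hk hp)]
  have hs (i : Fin n) (ℓ : Fin k) : Continuous fun W : Fin k → Fin d → ℝ => score x W i ℓ := by
    unfold score
    fun_prop
  refine continuous_finsetSum _ fun i _ => Continuous.sub (Continuous.log ?_ ?_) ?_
  · exact continuous_finsetSum _ fun ℓ _ => (hs i ℓ).rexp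
  · exact fun W => (sum_exp_pos hk _).ne'
  · exact continuous_finsetSum _ fun ℓ _ => (hs i ℓ).const_mul _

lemma hasDerivAt_logLoss (hk : 0 < k) (hp : p ∈ Simplex n k) (W D : Fin k → Fin d → ℝ) :
    HasDerivAt (fun t : ℝ => logLoss x p (W + t • D))
      (∑ ℓ, ∑ c, D ℓ c * (moment x (softmax x W) c ℓ - moment x p c ℓ)) 0 := by
  have hs (i : Fin n) (ℓ : Fin k) :
      HasDerivAt (fun t : ℝ => score x (W + t • D) i ℓ) (score x D i ℓ) 0 := by
    have h (t : ℝ) : score x (W + t • D) i ℓ = score x W i ℓ + t * score x D i ℓ := by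
      simp [score, add_mul, sum_add_distrib, mul_sum, mul_assoc]
    simp only [h]
    simpa using ((hasDerivAt_id (0 : ℝ)).mul_const (score x D i ℓ)).const_add (score x W i ℓ)
  have hlog (i : Fin n) : HasDerivAt
      (fun t : ℝ => Real.log (∑ ℓ, Real.exp (score x (W + t • D) i ℓ)))
      (∑ ℓ, softmax x W i ℓ * score x D i ℓ) 0 := by
    have h := (HasDerivAt.fun_sum (u := univ) fun ℓ _ => (hs i ℓ).exp).log (sum_exp_pos hk _).ne'
    convert h using 1
    simp [softmax, sum_div, div_mul_eq_mul_div]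
  have h := HasDerivAt.fun_sum (u := univ) fun i _ =>
    (hlog i).fun_sub (HasDerivAt.fun_sum (u := univ) fun ℓ _ => (hs i ℓ).const_mul (p i ℓ))
  rw [funext fun t : ℝ => logLoss_eq hk hp (W + t • D)]
  refine h.congr_deriv ?_
  simp only [mul_sub, sum_sub_distrib, sum_mul_score]

lemma exists_isMinOn_logLoss_add (hk : 0 < k) (hp : p ∈ Simplex n k) (hC : 0 < C) :
    ∃ W : Fin k → Fin d → ℝ, ∀ V,
      logLoss x p W + C * weightNorm W ≤ logLoss x p V + C * weightNorm V := by
  refine Continuous.exists_forall_le ((continuous_logLoss hk hp).add ?_) ?_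
  · unfold weightNorm
    fun_prop
  · refine Filter.tendsto_atTop_mono (fun W => ?_)
      ((tendsto_norm_cocompact_atTop (E := Fin k → Fin d → ℝ)).const_mul_atTop hC)
    have h₁ : 0 ≤ logLoss x p W := logLoss_nonneg hk hp
    have h₂ := mul_le_mul_of_nonneg_left (norm_le_weightNorm W) hC.le
    linarith

lemma neg_le_of_hasDerivAt_of_forall_le {f : ℝ → ℝ} {f' a : ℝ} (hf : HasDerivAt f f' 0)
    (h : ∀ t ∈ Set.Ioo (0 : ℝ) 1, f 0 ≤ f t + a * t) : -a ≤ f' := by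
  refine ge_of_tendsto (hf.tendsto_slope_zero_right) ?_
  filter_upwards [Ioo_mem_nhdsGT one_pos] with t ht
  have := h t ht
  rw [zero_add, smul_eq_mul, inv_mul_eq_div, le_div_iff₀ ht.1]
  linarith

/-- First-order optimality: the predictions at a minimizer of the regularized loss match the
moments up to `C`, and their entropy is at least the minimum. -/
lemma moment_and_entropy_of_isMin (hk : 0 < k) (hp : p ∈ Simplex n k) (hC : 0 ≤ C)
    (hW : ∀ V, logLoss x p W + C * weightNorm W ≤ logLoss x p V + C * weightNorm V) :
    (∀ c ℓ, |moment x (softmax x W) c ℓ - moment x p c ℓ| ≤ C) ∧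
      logLoss x p W + C * weightNorm W ≤ rowEntropy (softmax x W) := by
  have hdir (D : Fin k → Fin d → ℝ) : -(C * weightNorm D) ≤
      ∑ ℓ, ∑ c, D ℓ c * (moment x (softmax x W) c ℓ - moment x p c ℓ) := by
    refine neg_le_of_hasDerivAt_of_forall_le (hasDerivAt_logLoss hk hp W D) fun t ht => ?_
    have h₁ := hW (W + t • D)
    have h₂ := mul_le_mul_of_nonneg_left (weightNorm_add_le W (t • D)) hC
    rw [weightNorm_smul, abs_of_pos ht.1] at h₂
    simp only [zero_smul, add_zero]
    linarith
  constructor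
  · intro c ℓ
    have hsingle (s : ℝ) (hs : |s| = 1) :
        -C ≤ s * (moment x (softmax x W) c ℓ - moment x p c ℓ) := by
      have h := hdir (Pi.single ℓ (Pi.single c s))
      have hn : weightNorm (Pi.single ℓ (Pi.single c s) : Fin k → Fin d → ℝ) = 1 := by
        rw [weightNorm, Fintype.sum_eq_single ℓ (fun j hj => by simp [hj]),
          Fintype.sum_eq_single c (fun j hj => by simp [hj])]
        simpa using hs
      rw [hn, Fintype.sum_eq_single ℓ (fun j hj => by simp [hj]),
        Fintype.sum_eq_single c (fun j hj => by simp [hj])] at h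
      simpa using h
    have h₁ := hsingle 1 (by simp)
    have h₂ := hsingle (-1) (by simp)
    exact abs_le.2 ⟨by linarith, by linarith⟩
  · have hshrink : C * weightNorm W ≤
        ∑ ℓ, ∑ c, (-W) ℓ c * (moment x (softmax x W) c ℓ - moment x p c ℓ) := by
      rw [← neg_neg (C * weightNorm W)]
      refine neg_le_of_hasDerivAt_of_forall_le (hasDerivAt_logLoss hk hp W (-W)) fun t ht => ?_
      have h₁ := hW (W + t • -W)
      have h₂ : W + t • -W = (1 - t) • W := by module
      have h₃ : weightNorm (W + t • -W) = (1 - t) * weightNorm W := by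
        rw [h₂, weightNorm_smul, abs_of_pos (sub_pos.2 ht.2)]
      rw [h₃] at h₁
      simp only [zero_smul, add_zero]
      linarith
    have h := logLoss_sub_logLoss (x := x) hk hp (softmax_mem_simplex (x := x) (W := W) hk) W
    simp only [Pi.neg_apply, neg_mul, sum_neg_distrib] at hshrink
    rw [rowEntropy_softmax]
    linarith

lemma exists_moment_le_and_iInf_le (hk : 0 < k) (hp : p ∈ Simplex n k) (hC : 0 ≤ C) :
    ∃ z ∈ Simplex n k, (∀ c ℓ, |moment x z c ℓ - moment x p c ℓ| ≤ C) ∧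
      ⨅ W, ((logLoss x p W + C * weightNorm W : ℝ) : EReal) ≤ (rowEntropy z : EReal) := by
  have hpos (m : ℕ) : (0 : ℝ) < 1 / ((m : ℝ) + 1) := Nat.one_div_pos_of_nat
  choose W hW using fun m : ℕ =>
    exists_isMinOn_logLoss_add (x := x) hk hp (add_pos_of_nonneg_of_pos hC (hpos m))
  have hopt (m : ℕ) := moment_and_entropy_of_isMin hk hp (add_pos_of_nonneg_of_pos hC (hpos m)).le
    (hW m)
  obtain ⟨z, hz, φ, hφ, hlim⟩ := (isCompact_simplex n k).tendsto_subseq fun m =>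
    softmax_mem_simplex (x := x) (W := W m) hk
  refine ⟨z, hz, fun c ℓ => ?_, ?_⟩
  · have hcont : Continuous fun z : Fin n → Fin k → ℝ => |moment x z c ℓ - moment x p c ℓ| := by
      unfold moment
      fun_prop
    have hCm : Filter.Tendsto (fun m => C + 1 / ((φ m : ℝ) + 1)) Filter.atTop (nhds C) := by
      simpa using (tendsto_one_div_add_atTop_nhds_zero_nat.comp hφ.tendsto_atTop).const_add C
    exact le_of_tendsto_of_tendsto' ((hcont.tendsto z).comp hlim) hCm
      fun m => (hopt (φ m)).1 c ℓ
  · refine ge_of_tendsto' (((continuous_coe_real_ereal.comp continuous_rowEntropy).tendsto z).comp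
      hlim) fun m => (iInf_le _ (W (φ m))).trans (EReal.coe_le_coe_iff.2 ?_)
    have h₁ := (hopt (φ m)).2
    have h₂ := mul_nonneg (hpos (φ m)).le (weightNorm_nonneg (W (φ m)))
    rw [add_mul] at h₁
    simp only [Function.comp_apply]
    linarith

end

/-- ℓ1-regularized multiclass logistic regression is a BF
maximum-entropy problem. -/
theorem stmt18 {n k d : ℕ} (hn : 0 < n) (hk : 2 ≤ k) (hd : 0 < d)
    (x : Fin n → Fin d → ℝ) (η : Fin n → Fin k → ℝ) (hη : η ∈ Simplex n k)
    (C : ℝ) (hC : 0 ≤ C) :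
    -(⨅ z ∈ {z ∈ Simplex n k | ∀ (c : Fin d) (ℓ : Fin k),
          |(∑ i, x i c * z i ℓ) - ∑ i, x i c * η i ℓ| ≤ C},
        dotlog z z)
      = ⨅ W : Fin k → Fin d → ℝ,
          (((-(∑ i, ∑ ℓ, η i ℓ * Real.log (Real.exp (∑ c, W ℓ c * x i c)
                / ∑ ℓ', Real.exp (∑ c, W ℓ' c * x i c))))
            + C * ∑ ℓ, ∑ c, |W ℓ c| : ℝ) : EReal) := by
  have hk' : 0 < k := by omega
  change _ = ⨅ W, ((logLoss x η W + C * weightNorm W : ℝ) : EReal)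
  simp only [dotlog_self]
  apply le_antisymm
  · refine le_iInf fun W => EReal.neg_le.1 (le_iInf₂ fun z hz => ?_)
    rw [← EReal.coe_neg, EReal.coe_le_coe_iff]
    exact neg_le_neg (rowEntropy_le_logLoss_add hk' hz.1 hη hz.2 W)
  · obtain ⟨z, hz, hmom, hle⟩ := exists_moment_le_and_iInf_le (x := x) hk' hη hC
    refine hle.trans (EReal.le_neg_of_le_neg ((iInf₂_le z ⟨hz, hmom⟩).trans_eq ?_))
    exact EReal.coe_neg _
end
end

section
/- (A symmetric two-rule binary instance where BF infers the correct label proportions.) Let k = 2, p = 2, m = 4, and let two non-abstaining rules h1, h2 : Fin n → Fin 2 be given (so n_1 = n_2 = n). With labels written as {1,2}, for ℓ, ℓ', ℓ'' ∈ {1,2} set r_{ℓ,ℓ'ℓ''} := Σ_i η_{iℓ}·[h1 i = ℓ']·[h2 i = ℓ''] and c_{ℓ'ℓ''} := |{i : h1 i = ℓ', h2 i = ℓ''}|. Assume all eight values r_{ℓ,ℓ'ℓ''} are positive and that c_{11} = c_{22}, c_{12} = c_{21}, r_{1,11} = r_{2,22}, r_{1,12} = r_{2,21}, and r_{2,12}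 = r_{1,21}. Define θ ∈ ℝ^4 (coordinates ordered: rule 1, rule 2, class 1, class 2) by θ_1 = n·log√( (r_{1,11}/r_{2,11})·(r_{1,12}/r_{2,12}) ), θ_2 = n·log√( (r_{1,11}/r_{2,11})·(r_{2,12}/r_{1,12}) ), and θ_3 = θ_4 = n. Then for every i and every ℓ ∈ {1,2}, g^{(θ)}_{iℓ} = r_{ℓ, (h1 i)(h2 i)} / c_{(h1 i)(h2 i)}; consequently A g^{(θ)} = A η, so θ maximizes the concave dual function θ' ↦ θ'·(A η) − Σ_i log( Σ_ℓ exp(a^{(θ')}_{iℓ}) ) over ℝ^4 and g^{(θ)} infers the correct proportion of labels. -/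
open Finset

attribute [local instance] Classical.propDecidable

noncomputable section

/-- The constraint matrix `A` for two non-abstaining rules on binary labels
(`m = 4` rows: two rule-accuracy rows and two class-frequency rows). -/
def A2 {n : ℕ} (h1 h2 : Fin n → Fin 2) : Fin 2 ⊕ Fin 2 → Fin n → Fin 2 → ℝ
  | Sum.inl j => fun i ℓ => if ![h1, h2] j i = ℓ then 1 / (n : ℝ) else 0
  | Sum.inr ℓ' => fun i ℓ => if ℓ = ℓ' then 1 / (n : ℝ) else 0

/-- `(A z)_j`. -/
def applyA2 {n : ℕ} (h1 h2 : Fin n → Fin 2) (z : Fin n → Fin 2 → ℝ)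
    (j : Fin 2 ⊕ Fin 2) : ℝ :=
  ∑ i, ∑ ℓ, A2 h1 h2 j i ℓ * z i ℓ

/-- `a^{(θ)}_{iℓ}`. -/
def avec2 {n : ℕ} (h1 h2 : Fin n → Fin 2) (θ : Fin 2 ⊕ Fin 2 → ℝ)
    (i : Fin n) (ℓ : Fin 2) : ℝ :=
  ∑ j, θ j * A2 h1 h2 j i ℓ

/-- The exponential-family (softmax) prediction `g^{(θ)}`. -/
def gexp2 {n : ℕ} (h1 h2 : Fin n → Fin 2) (θ : Fin 2 ⊕ Fin 2 → ℝ)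
    (i : Fin n) (ℓ : Fin 2) : ℝ :=
  Real.exp (avec2 h1 h2 θ i ℓ) / ∑ ℓ', Real.exp (avec2 h1 h2 θ i ℓ')

/-- `r_{ℓ,ℓ'ℓ''} = Σ_i η_{iℓ}·[h1 i = ℓ']·[h2 i = ℓ'']`
(label `1` is index `0`, label `2` is index `1`). -/
def rval {n : ℕ} (η : Fin n → Fin 2 → ℝ) (h1 h2 : Fin n → Fin 2)
    (ℓ ℓ' ℓ'' : Fin 2) : ℝ :=
  ∑ i, η i ℓ * (if h1 i = ℓ' then (1 : ℝ) else 0) * (if h2 i = ℓ'' then (1 : ℝ) else 0)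

/-- `c_{ℓ'ℓ''} = |{i : h1 i = ℓ', h2 i = ℓ''}|`. -/
def cval {n : ℕ} (h1 h2 : Fin n → Fin 2) (ℓ' ℓ'' : Fin 2) : ℝ :=
  ((Finset.univ.filter (fun i => h1 i = ℓ' ∧ h2 i = ℓ'')).card : ℝ)

/-- The gradient inequality for log-sum-exp. -/
lemma log_sum_exp_gradient {ι : Type*} [Fintype ι] [Nonempty ι] (a a' : ι → ℝ) :
    ∑ l, Real.exp (a l) / (∑ l', Real.exp (a l')) * (a' l - a l)
      ≤ Real.log (∑ l, Real.exp (a' l)) - Real.log (∑ l, Real.exp (a l)) := by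
  have hS : 0 < ∑ l, Real.exp (a l) := by positivity
  have hS' : 0 < ∑ l, Real.exp (a' l) := by positivity
  set S := ∑ l, Real.exp (a l) with hSdef
  set S' := ∑ l, Real.exp (a' l) with hSdef'
  have key : ∀ l, Real.exp (a l) / S * (a' l - a l)
      ≤ Real.exp (a l) / S * (Real.log S' - Real.log S - 1) + Real.exp (a' l) / S' := by
    intro l
    have h := Real.add_one_le_exp (a' l - a l - (Real.log S' - Real.log S))
    have hp : 0 ≤ Real.exp (a l) / S := by positivity
    have he : Real.exp (a l) / S * Real.exp (a' l - a l - (Real.log S' - Real.log S))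
        = Real.exp (a' l) / S' := by
      rw [Real.exp_sub, Real.exp_sub, Real.exp_sub, Real.exp_log hS, Real.exp_log hS']
      field_simp
    rw [← he]
    nlinarith [mul_le_mul_of_nonneg_left h hp]
  refine (Finset.sum_le_sum fun l _ => key l).trans_eq ?_
  rw [Finset.sum_add_distrib, ← Finset.sum_mul, ← Finset.sum_div, ← Finset.sum_div, ← hSdef,
    ← hSdef', div_self hS.ne', div_self hS'.ne']
  ring

lemma sum_mul_applyA2 {n : ℕ} (h1 h2 : Fin n → Fin 2) (θ : Fin 2 ⊕ Fin 2 → ℝ)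
    (z : Fin n → Fin 2 → ℝ) :
    ∑ j, θ j * applyA2 h1 h2 z j = ∑ i, ∑ l, z i l * avec2 h1 h2 θ i l := by
  simp only [applyA2, avec2, Finset.mul_sum]
  rw [Finset.sum_comm]
  refine Finset.sum_congr rfl fun i _ => ?_
  rw [Finset.sum_comm]
  refine Finset.sum_congr rfl fun l _ => Finset.sum_congr rfl fun j _ => ?_
  ring

/-- A point whose prediction matches the moments of `z` maximizes the dual function at `z`. -/
lemma dual_le_of_applyA2_eq {n : ℕ} (h1 h2 : Fin n → Fin 2) (z : Fin n → Fin 2 → ℝ)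
    (θ : Fin 2 ⊕ Fin 2 → ℝ)
    (h : ∀ j, applyA2 h1 h2 (gexp2 h1 h2 θ) j = applyA2 h1 h2 z j) (θ' : Fin 2 ⊕ Fin 2 → ℝ) :
    (∑ j, θ' j * applyA2 h1 h2 z j)
        - (∑ i, Real.log (∑ l, Real.exp (avec2 h1 h2 θ' i l)))
      ≤ (∑ j, θ j * applyA2 h1 h2 z j)
        - ∑ i, Real.log (∑ l, Real.exp (avec2 h1 h2 θ i l)) := by
  simp only [← h, sum_mul_applyA2]
  have := Finset.sum_le_sum fun i (_ : i ∈ Finset.univ) =>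
    log_sum_exp_gradient (avec2 h1 h2 θ i) (avec2 h1 h2 θ' i)
  simp only [mul_sub, Finset.sum_sub_distrib] at this
  simp only [gexp2]
  linarith

lemma sum_mul_eq_sum_cells {n : ℕ} (h1 h2 : Fin n → Fin 2) (f : Fin 2 → Fin 2 → ℝ)
    (z : Fin n → Fin 2 → ℝ) (l : Fin 2) :
    ∑ i, f (h1 i) (h2 i) * z i l = ∑ a, ∑ b, f a b * rval z h1 h2 l a b := by
  simp only [rval, Finset.mul_sum]
  rw [Finset.sum_congr rfl fun a _ => Finset.sum_comm, Finset.sum_comm]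
  refine Finset.sum_congr rfl fun i _ => ?_
  simp

lemma rval_const {n : ℕ} (h1 h2 : Fin n → Fin 2) (f : Fin 2 → Fin 2 → Fin 2 → ℝ)
    (l a b : Fin 2) :
    rval (fun i l => f l (h1 i) (h2 i)) h1 h2 l a b = cval h1 h2 a b * f l a b := by
  simp only [rval, cval, Finset.card_filter, Nat.cast_sum, Finset.sum_mul]
  refine Finset.sum_congr rfl fun i _ => ?_
  by_cases ha : h1 i = a <;> by_cases hb : h2 i = b <;> simp [ha, hb]

lemma rval_add_rval {n : ℕ} {h1 h2 : Fin n → Fin 2} {η : Fin n → Fin 2 → ℝ}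
    (hη : η ∈ Simplex n 2) (a b : Fin 2) :
    rval η h1 h2 0 a b + rval η h1 h2 1 a b = cval h1 h2 a b := by
  simp only [rval, cval, Finset.card_filter, Nat.cast_sum, ← Finset.sum_add_distrib]
  refine Finset.sum_congr rfl fun i _ => ?_
  have := hη.2 i
  rw [Fin.sum_univ_two] at this
  by_cases ha : h1 i = a <;> by_cases hb : h2 i = b <;> simp [ha, hb, this]

/-- Averaging over the cells of the two rules preserves `A z`. -/
lemma applyA2_cell_average {n : ℕ} (h1 h2 : Fin n → Fin 2) (η : Fin n → Fin 2 → ℝ)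
    (hc : ∀ a b, cval h1 h2 a b ≠ 0) (j : Fin 2 ⊕ Fin 2) :
    applyA2 h1 h2 (fun i l => rval η h1 h2 l (h1 i) (h2 i) / cval h1 h2 (h1 i) (h2 i)) j
      = applyA2 h1 h2 η j := by
  obtain ⟨F, hF⟩ : ∃ F : Fin 2 → Fin 2 → Fin 2 → ℝ,
      ∀ i l, A2 h1 h2 j i l = F l (h1 i) (h2 i) := by
    rcases j with j | l'
    · exact ⟨fun l a b => if ![a, b] j = l then 1 / (n : ℝ) else 0, fun i l => by
        fin_cases j <;> rfl⟩
    · exact ⟨fun l _ _ => if l = l' then 1 / (n : ℝ) else 0, fun i l => rfl⟩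
  simp only [applyA2, hF]
  rw [Finset.sum_comm, Finset.sum_comm (f := fun i l => F l (h1 i) (h2 i) * η i l)]
  refine Finset.sum_congr rfl fun l _ => ?_
  rw [sum_mul_eq_sum_cells h1 h2 (F l) η l, sum_mul_eq_sum_cells h1 h2 (F l)
    (fun i l => rval η h1 h2 l (h1 i) (h2 i) / cval h1 h2 (h1 i) (h2 i)) l]
  refine Finset.sum_congr rfl fun a _ => Finset.sum_congr rfl fun b _ => ?_
  rw [rval_const h1 h2 (fun l a b => rval η h1 h2 l a b / cval h1 h2 a b),
    mul_div_cancel₀ _ (hc a b)]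

/-- Two-class softmax from the ratio of the exponentials. -/
lemma softmax_two {x y p q : ℝ} (hp : 0 < p) (hq : 0 < q)
    (h : x - y = Real.log p - Real.log q) :
    Real.exp x / (Real.exp x + Real.exp y) = p / (p + q) ∧
      Real.exp y / (Real.exp x + Real.exp y) = q / (p + q) := by
  have hx : Real.exp x = p / q * Real.exp y := by
    rw [show x = Real.log p - Real.log q + y by linarith, Real.exp_add, Real.exp_sub,
      Real.exp_log hp, Real.exp_log hq]
  have := Real.exp_pos y
  rw [hx]
  constructor <;> field_simp

/-- a symmetric two-rule binary instance where BF infers the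
correct label proportions, and the exhibited weights maximize the dual. -/
theorem stmt19 {n : ℕ} (hn : 0 < n) (h1 h2 : Fin n → Fin 2)
    (η : Fin n → Fin 2 → ℝ) (hη : η ∈ Simplex n 2)
    (hrpos : ∀ ℓ ℓ' ℓ'', 0 < rval η h1 h2 ℓ ℓ' ℓ'')
    (hc1 : cval h1 h2 0 0 = cval h1 h2 1 1)
    (hc2 : cval h1 h2 0 1 = cval h1 h2 1 0)
    (hr1 : rval η h1 h2 0 0 0 = rval η h1 h2 1 1 1)
    (hr2 : rval η h1 h2 0 0 1 = rval η h1 h2 1 1 0)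
    (hr3 : rval η h1 h2 1 0 1 = rval η h1 h2 0 1 0)
    (θ : Fin 2 ⊕ Fin 2 → ℝ)
    (hθ : θ = Sum.elim
      ![(n : ℝ) * Real.log (Real.sqrt ((rval η h1 h2 0 0 0 / rval η h1 h2 1 0 0)
            * (rval η h1 h2 0 0 1 / rval η h1 h2 1 0 1))),
        (n : ℝ) * Real.log (Real.sqrt ((rval η h1 h2 0 0 0 / rval η h1 h2 1 0 0)
            * (rval η h1 h2 1 0 1 / rval η h1 h2 0 0 1)))]
      ![(n : ℝ), (n : ℝ)]) :
    (∀ i ℓ, gexp2 h1 h2 θ i ℓ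
        = rval η h1 h2 ℓ (h1 i) (h2 i) / cval h1 h2 (h1 i) (h2 i))
    ∧ (∀ j, applyA2 h1 h2 (gexp2 h1 h2 θ) j = applyA2 h1 h2 η j)
    ∧ ∀ θ' : Fin 2 ⊕ Fin 2 → ℝ,
        (∑ j, θ' j * applyA2 h1 h2 η j)
            - (∑ i, Real.log (∑ ℓ, Real.exp (avec2 h1 h2 θ' i ℓ)))
          ≤ (∑ j, θ j * applyA2 h1 h2 η j)
            - ∑ i, Real.log (∑ ℓ, Real.exp (avec2 h1 h2 θ i ℓ)) := by
  have hc := fun a b => rval_add_rval (h1 := h1) (h2 := h2) hη a b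
  have hcne : ∀ a b, cval h1 h2 a b ≠ 0 := fun a b => by
    rw [← hc a b]; exact (add_pos (hrpos 0 a b) (hrpos 1 a b)).ne'
  have hr4 : rval η h1 h2 0 1 1 = rval η h1 h2 1 0 0 := by
    linarith [hc 0 0, hc 1 1]
  have hn' : (n : ℝ) ≠ 0 := by positivity
  have hlog : ∀ {p q r s : ℝ}, 0 < p → 0 < q → 0 < r → 0 < s →
      Real.log (Real.sqrt (p / q * (r / s)))
        = (Real.log p - Real.log q + (Real.log r - Real.log s)) / 2 := by
    intro p q r s hp hq hr hs
    rw [Real.log_sqrt (by positivity), Real.log_mul (by positivity) (by positivity),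
      Real.log_div hp.ne' hq.ne', Real.log_div hr.ne' hs.ne']
  rw [hlog (hrpos _ _ _) (hrpos _ _ _) (hrpos _ _ _) (hrpos _ _ _),
    hlog (hrpos _ _ _) (hrpos _ _ _) (hrpos _ _ _) (hrpos _ _ _)] at hθ
  have hdiff : ∀ i, avec2 h1 h2 θ i 0 - avec2 h1 h2 θ i 1
      = Real.log (rval η h1 h2 0 (h1 i) (h2 i)) - Real.log (rval η h1 h2 1 (h1 i) (h2 i)) := by
    intro i
    have cases2 : ∀ x : Fin 2, x = 0 ∨ x = 1 := by decide
    rcases cases2 (h1 i) with ha | ha <;> rcases cases2 (h2 i) with hb | hb <;>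
      simp [avec2, A2, hθ, ha, hb, ← hr1, ← hr2, ← hr3, hr4] <;> field_simp <;> ring
  have hg : ∀ i l, gexp2 h1 h2 θ i l
      = rval η h1 h2 l (h1 i) (h2 i) / cval h1 h2 (h1 i) (h2 i) := by
    intro i l
    have := softmax_two (hrpos 0 (h1 i) (h2 i)) (hrpos 1 (h1 i) (h2 i)) (hdiff i)
    rw [gexp2, Fin.sum_univ_two, ← hc]
    fin_cases l
    · exact this.1
    · exact this.2
  have hA : ∀ j, applyA2 h1 h2 (gexp2 h1 h2 θ) j = applyA2 h1 h2 η j := fun j => by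
    rw [← applyA2_cell_average h1 h2 η hcne j]
    exact congrArg (fun z => applyA2 h1 h2 z j) (funext fun i => funext fun l => hg i l)
  exact ⟨hg, hA, dual_le_of_applyA2_eq h1 h2 η θ hA⟩
end
end
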